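/- Typed fixpoint yields a self-increasing term: in the calculus extended with the fixpoint combinator Y, if Δ ⊢ b : B is a valid typing judgment, then setting Y_b := Y(λx.[b+¡x]) one has that Δ ⊢ Y_b : B is a valid typing judgment and Y_b →* b + Y_b. -/

import Mathlib

/-!
Formalization of the computational algebraic lambda-calculus
(simply-typed, call-by-value lambda-calculus endowed with a structure of
module over a ring `R` of scalars), using de Bruijn indices
(so that α-equivalence is definitional and substitution is capture-avoiding).
-/

namespace AlgLC

/-- Simple types: base types, arrows, products, unit `⊤`, and the monadic type `M A`. -/
inductive Ty (ι : Type) : Type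
  | base : ι → Ty ι
  | arrow : Ty ι → Ty ι → Ty ι
  | prod : Ty ι → Ty ι → Ty ι
  | unit : Ty ι
  | m : Ty ι → Ty ι

/-- Terms (de Bruijn representation): variables, abstraction, application,
pairs `⟨s,t⟩`, projections `π₁ s`, `π₂ s`, the unit `∗`, sums `s+t`,
scalar multiplications `α·s`, the null term `𝟎`, closures `[s]` and
the "run" construct `¡s`. -/
inductive Term (R : Type) : Type
  | var : ℕ → Term R
  | lam : Term R → Term R
  | app : Term R → Term R → Term R
  | pair : Term R → Term R → Term R
  | fst : Term R → Term R
  | snd : Term R → Term R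
  | star : Term R
  | add : Term R → Term R → Term R
  | smul : R → Term R → Term R
  | zero : Term R
  | clos : Term R → Term R
  | unclos : Term R → Term R
  | fix : Term R → Term R

variable {R : Type} {ι : Type}

/-- Shift the free de Bruijn indices `≥ k` up by `d`. -/
def lift (d : ℕ) : ℕ → Term R → Term R
  | k, .var n => .var (if n < k then n else n + d)
  | k, .lam t => .lam (lift d (k+1) t)
  | k, .app s t => .app (lift d k s) (lift d k t)
  | k, .pair s t => .pair (lift d k s) (lift d k t)
  | k, .fst s => .fst (lift d k s)
  | k, .snd s => .snd (lift d k s)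
  | _, .star => .star
  | k, .add s t => .add (lift d k s) (lift d k t)
  | k, .smul a s => .smul a (lift d k s)
  | _, .zero => .zero
  | k, .clos s => .clos (lift d k s)
  | k, .unclos s => .unclos (lift d k s)
  | k, .fix s => .fix (lift d k s)

/-- Capture-avoiding substitution `s[k := v]` of `v` for the de Bruijn index `k`. -/
def subst : Term R → ℕ → Term R → Term R
  | .var n, k, v => if n = k then v else if n < k then .var n else .var (n-1)
  | .lam t, k, v => .lam (subst t (k+1) (lift 1 0 v))
  | .app s t, k, v => .app (subst s k v) (subst t k v)
  | .pair s t, k, v => .pair (subst s k v) (subst t k v)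
  | .fst s, k, v => .fst (subst s k v)
  | .snd s, k, v => .snd (subst s k v)
  | .star, _, _ => .star
  | .add s t, k, v => .add (subst s k v) (subst t k v)
  | .smul a s, k, v => .smul a (subst s k v)
  | .zero, _, _ => .zero
  | .clos s, k, v => .clos (subst s k v)
  | .unclos s, k, v => .unclos (subst s k v)
  | .fix s, k, v => .fix (subst s k v)

/-- Values: `u,v ::= x | λx.u | u v | ⟨u,v⟩ | π₁ u | π₂ u | ∗ | [s]`. -/
inductive IsValue : Term R → Prop
  | var {n} : IsValue (.var n)
  | lam {u} : IsValue u → IsValue (.lam u)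
  | app {u v} : IsValue u → IsValue v → IsValue (.app u v)
  | pair {u v} : IsValue u → IsValue v → IsValue (.pair u v)
  | fst {u} : IsValue u → IsValue (.fst u)
  | snd {u} : IsValue u → IsValue (.snd u)
  | star : IsValue .star
  | clos {s} : IsValue (.clos s)

/-- Typing judgments `Δ ⊢ s : A` (the context is a list of types, de Bruijn style). -/
inductive Typed : List (Ty ι) → Term R → Ty ι → Prop
  | var {Γ : List (Ty ι)} {n A} : Γ[n]? = some A → Typed Γ (.var n) A
  | star {Γ} : Typed Γ .star .unit
  | zero {Γ A} : Typed Γ .zero A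
  | lam {Γ s A B} : Typed (A :: Γ) s B → Typed Γ (.lam s) (.arrow A B)
  | app {Γ s t A B} : Typed Γ s (.arrow A B) → Typed Γ t A → Typed Γ (.app s t) B
  | pair {Γ s t A B} : Typed Γ s A → Typed Γ t B → Typed Γ (.pair s t) (.prod A B)
  | fst {Γ s A B} : Typed Γ s (.prod A B) → Typed Γ (.fst s) A
  | snd {Γ s A B} : Typed Γ s (.prod A B) → Typed Γ (.snd s) B
  | smul {Γ s A} (a : R) : Typed Γ s A → Typed Γ (.smul a s) A
  | add {Γ s t A} : Typed Γ s A → Typed Γ t A → Typed Γ (.add s t) A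
  | clos {Γ s A} : Typed Γ s A → Typed Γ (.clos s) (.m A)
  | unclos {Γ s A} : Typed Γ s (.m A) → Typed Γ (.unclos s) A
  | fix {Γ s A} : Typed Γ s (.arrow (.m A) (.m A)) → Typed Γ (.fix s) A

/-- `≃_AC` : the smallest congruent equivalence relation containing
commutativity and associativity of `+`. -/
inductive AC : Term R → Term R → Prop
  | comm {s t} : AC (.add s t) (.add t s)
  | assoc {r s t} : AC (.add r (.add s t)) (.add (.add r s) t)
  | refl (s) : AC s s
  | symm {s t} : AC s t → AC t s
  | trans {s t u} : AC s t → AC t u → AC s u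
  | lam {s s'} : AC s s' → AC (.lam s) (.lam s')
  | appL {s s' t} : AC s s' → AC (.app s t) (.app s' t)
  | appR {s t t'} : AC t t' → AC (.app s t) (.app s t')
  | pairL {s s' t} : AC s s' → AC (.pair s t) (.pair s' t)
  | pairR {s t t'} : AC t t' → AC (.pair s t) (.pair s t')
  | fst {s s'} : AC s s' → AC (.fst s) (.fst s')
  | snd {s s'} : AC s s' → AC (.snd s) (.snd s')
  | addL {s s' t} : AC s s' → AC (.add s t) (.add s' t)
  | addR {s t t'} : AC t t' → AC (.add s t) (.add s t')
  | smul {a s s'} : AC s s' → AC (.smul a s) (.smul a s')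
  | clos {s s'} : AC s s' → AC (.clos s) (.clos s')
  | unclos {s s'} : AC s s' → AC (.unclos s) (.unclos s')
  | fix {s s'} : AC s s' → AC (.fix s) (.fix s')

section Rules

variable [Ring R]

/-- The rules of group E. -/
inductive RuleE : Term R → Term R → Prop
  | smul_zero (a : R) : RuleE (.smul a .zero) .zero
  | zero_smul (s : Term R) : RuleE (.smul 0 s) .zero
  | one_smul (s : Term R) : RuleE (.smul 1 s) s
  | zero_add (s : Term R) : RuleE (.add .zero s) s
  | smul_smul (a b : R) (s : Term R) : RuleE (.smul a (.smul b s)) (.smul (a * b) s)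
  | smul_add (a : R) (s t : Term R) :
      RuleE (.smul a (.add s t)) (.add (.smul a s) (.smul a t))

/-- The rules of group F. -/
inductive RuleF : Term R → Term R → Prop
  | add_smul (a b : R) (s : Term R) :
      RuleF (.add (.smul a s) (.smul b s)) (.smul (a + b) s)
  | smul_self (a : R) (s : Term R) : RuleF (.add (.smul a s) s) (.smul (a + 1) s)
  | self_self (s : Term R) : RuleF (.add s s) (.smul (1 + 1) s)

/-- The rules of group A. -/
inductive RuleA : Term R → Term R → Prop
  | add_app (s t r : Term R) : RuleA (.app (.add s t) r) (.add (.app s r) (.app t r))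
  | app_add (r s t : Term R) : RuleA (.app r (.add s t)) (.add (.app r s) (.app r t))
  | smul_app (a : R) (s r : Term R) : RuleA (.app (.smul a s) r) (.smul a (.app s r))
  | app_smul (a : R) (r s : Term R) : RuleA (.app r (.smul a s)) (.smul a (.app r s))
  | zero_app (r : Term R) : RuleA (.app .zero r) .zero
  | app_zero (r : Term R) : RuleA (.app r .zero) .zero
  | lam_add (s t : Term R) : RuleA (.lam (.add s t)) (.add (.lam s) (.lam t))
  | lam_smul (a : R) (s : Term R) : RuleA (.lam (.smul a s)) (.smul a (.lam s))
  | lam_zero : RuleA (.lam .zero) (.zero : Term R)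
  | unclos_add (s t : Term R) : RuleA (.unclos (.add s t)) (.add (.unclos s) (.unclos t))
  | unclos_smul (a : R) (s : Term R) : RuleA (.unclos (.smul a s)) (.smul a (.unclos s))
  | unclos_zero : RuleA (.unclos .zero) (.zero : Term R)

/-- The rules of group B: call-by-value β, running a closure, projections of pairs of values. -/
inductive RuleB : Term R → Term R → Prop
  | beta {s v : Term R} : IsValue v → RuleB (.app (.lam s) v) (subst s 0 v)
  | run (s : Term R) : RuleB (.unclos (.clos s)) s
  | fst {u v : Term R} : IsValue u → IsValue v → RuleB (.fst (.pair u v)) u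
  | snd {u v : Term R} : IsValue u → IsValue v → RuleB (.snd (.pair u v)) v
  | fix {v : Term R} : IsValue v → RuleB (.fix v) (.unclos (.app v (.clos (.fix v))))

end Rules

/-- The smallest call-by-value congruent relation (closed under every term
construct except λ-abstraction and closures `[·]`) consistent with `≃_AC`
generated by a set `Rb` of basic rules. -/
inductive Step (Rb : Term R → Term R → Prop) : Term R → Term R → Prop
  | base {s t} : Rb s t → Step Rb s t
  | appL {s s' t} : Step Rb s s' → Step Rb (.app s t) (.app s' t)
  | appR {s t t'} : Step Rb t t' → Step Rb (.app s t) (.app s t')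
  | pairL {s s' t} : Step Rb s s' → Step Rb (.pair s t) (.pair s' t)
  | pairR {s t t'} : Step Rb t t' → Step Rb (.pair s t) (.pair s t')
  | fst {s s'} : Step Rb s s' → Step Rb (.fst s) (.fst s')
  | snd {s s'} : Step Rb s s' → Step Rb (.snd s) (.snd s')
  | addL {s s' t} : Step Rb s s' → Step Rb (.add s t) (.add s' t)
  | addR {s t t'} : Step Rb t t' → Step Rb (.add s t) (.add s t')
  | smul {a s s'} : Step Rb s s' → Step Rb (.smul a s) (.smul a s')
  | unclos {s s'} : Step Rb s s' → Step Rb (.unclos s) (.unclos s')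
  | fix {s s'} : Step Rb s s' → Step Rb (.fix s) (.fix s')
  | ac {s s' t t'} : AC s s' → Step Rb s' t' → AC t' t → Step Rb s t

variable [Ring R]

/-- The one-step reduction `→` of the full system `L = E ∪ F ∪ A ∪ B`. -/
def StepL : Term R → Term R → Prop :=
  Step (fun s t => RuleE s t ∨ RuleF s t ∨ RuleA s t ∨ RuleB s t)

/-- The one-step reduction of the purely algebraic system `E ∪ F ∪ A`. -/
def StepEFA : Term R → Term R → Prop :=
  Step (fun s t => RuleE s t ∨ RuleF s t ∨ RuleA s t)


/-- `Y_b := Y(λx.[b + ¡x])` (the free variables of `b` are lifted under the binder). -/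
def Yfix (b : Term R) : Term R :=
  .fix (.lam (.clos (.add (lift 1 0 b) (.unclos (.var 0)))))

/-- Weakening: a type inserted at position `Ξ.length` of the context. -/
theorem Typed.lift_one {R ι : Type} {Γ : List (Ty ι)} {s : Term R} {A : Ty ι}
    (C : Ty ι) (h : Typed Γ s A) :
    ∀ Ξ Δ : List (Ty ι), Γ = Ξ ++ Δ → Typed (Ξ ++ C :: Δ) (lift 1 Ξ.length s) A := by
  induction h with
  | @var Γ n A h =>
    rintro Ξ Δ rfl
    apply Typed.var
    split_ifs with hn
    · rwa [List.getElem?_append_left hn] at h ⊢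
    · rw [not_lt] at hn
      rw [List.getElem?_append_right hn] at h
      rw [List.getElem?_append_right (by omega), Nat.sub_add_comm hn, List.getElem?_cons_succ]
      exact h
  | star => exact fun _ _ _ => .star
  | zero => exact fun _ _ _ => .zero
  | @lam Γ s A B _ ih =>
    rintro Ξ Δ rfl
    exact .lam (ih (A :: Ξ) Δ rfl)
  | app _ _ ih₁ ih₂ => exact fun Ξ Δ e => .app (ih₁ Ξ Δ e) (ih₂ Ξ Δ e)
  | pair _ _ ih₁ ih₂ => exact fun Ξ Δ e => .pair (ih₁ Ξ Δ e) (ih₂ Ξ Δ e)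
  | fst _ ih => exact fun Ξ Δ e => .fst (ih Ξ Δ e)
  | snd _ ih => exact fun Ξ Δ e => .snd (ih Ξ Δ e)
  | smul a _ ih => exact fun Ξ Δ e => .smul a (ih Ξ Δ e)
  | add _ _ ih₁ ih₂ => exact fun Ξ Δ e => .add (ih₁ Ξ Δ e) (ih₂ Ξ Δ e)
  | clos _ ih => exact fun Ξ Δ e => .clos (ih Ξ Δ e)
  | unclos _ ih => exact fun Ξ Δ e => .unclos (ih Ξ Δ e)
  | fix _ ih => exact fun Ξ Δ e => .fix (ih Ξ Δ e)

/-- Substituting for an index that does not occur undoes the shift. -/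
theorem subst_lift_one {R : Type} (s : Term R) (k : ℕ) (v : Term R) :
    subst (lift 1 k s) k v = s := by
  induction s generalizing k v with
  | var n =>
    by_cases hn : n < k
    · simp [lift, subst, hn, hn.ne]
    · have h₁ : n + 1 ≠ k := by omega
      have h₂ : ¬ n + 1 < k := by omega
      simp [lift, subst, hn, h₁, h₂]
  | _ => simp_all [lift, subst]

/-- **Typed fixpoint yields a self-increasing term** : if `Δ ⊢ b : B` then
`Δ ⊢ Y_b : B` and `Y_b →* b + Y_b`. -/
theorem typed_fixpoint {Γ : List (Ty ι)} {b : Term R} {B : Ty ι} (hb : Typed Γ b B) :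
    Typed Γ (Yfix b) B ∧ Relation.ReflTransGen StepL (Yfix b) (.add b (Yfix b)) := by
  refine ⟨.fix (.lam (.clos (.add (hb.lift_one (.m B) [] Γ rfl) (.unclos (.var rfl))))), ?_⟩
  have beta : StepL (.app (.lam (.clos (.add (lift 1 0 b) (.unclos (.var 0))))) (.clos (Yfix b)))
      (.clos (.add b (.unclos (.clos (Yfix b))))) := by
    have h := RuleB.beta (s := .clos (.add (lift 1 0 b) (.unclos (.var 0))))
      (IsValue.clos (s := Yfix b))
    simp only [subst, subst_lift_one, if_true] at h
    exact .base (.inr (.inr (.inr h)))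
  exact .head (.base (.inr (.inr (.inr (.fix (.lam .clos)))))) <|
    .head (.unclos beta) <|
    .head (.base (.inr (.inr (.inr (.run _))))) <|
    .single (.addR (.base (.inr (.inr (.inr (.run _))))))

end AlgLC
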